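/- The first type of Bagderina's classification coincides with the case of general position of the earlier classification: at every point (x, y), J₀(x,y) ≠ 0 if and only if Φ(x,y) ≠ 0. -/

import Mathlib

open Function

noncomputable section

/-- Partial derivative in the first variable. -/
def pdx (f : ℝ → ℝ → ℝ) : ℝ → ℝ → ℝ := fun x y => deriv (fun t => f t y) x

/-- Partial derivative in the second variable. -/
def pdy (f : ℝ → ℝ → ℝ) : ℝ → ℝ → ℝ := fun x y => deriv (fun t => f x t) y

def al0 (P Q R S : ℝ → ℝ → ℝ) : ℝ → ℝ → ℝ := fun x y =>
  pdx Q x y - pdy P x y + 2 * P x y * R x y - 2 * Q x y ^ 2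

def al1 (P Q R S : ℝ → ℝ → ℝ) : ℝ → ℝ → ℝ := fun x y =>
  pdx R x y - pdy Q x y + P x y * S x y - Q x y * R x y

def al2 (P Q R S : ℝ → ℝ → ℝ) : ℝ → ℝ → ℝ := fun x y =>
  pdx S x y - pdy R x y + 2 * Q x y * S x y - 2 * R x y ^ 2

def b1 (P Q R S : ℝ → ℝ → ℝ) : ℝ → ℝ → ℝ := fun x y =>
  pdx (al1 P Q R S) x y - pdy (al0 P Q R S) x y + R x y * al0 P Q R S x y - 2 * Q x y * al1 P Q R S x y + P x y * al2 P Q R S x y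

def b2 (P Q R S : ℝ → ℝ → ℝ) : ℝ → ℝ → ℝ := fun x y =>
  pdx (al2 P Q R S) x y - pdy (al1 P Q R S) x y + S x y * al0 P Q R S x y - 2 * R x y * al1 P Q R S x y + Q x y * al2 P Q R S x y

def g10 (P Q R S : ℝ → ℝ → ℝ) : ℝ → ℝ → ℝ := fun x y =>
  pdx (b1 P Q R S) x y - Q x y * b1 P Q R S x y + P x y * b2 P Q R S x y

def g11 (P Q R S : ℝ → ℝ → ℝ) : ℝ → ℝ → ℝ := fun x y =>
  pdx (b2 P Q R S) x y - R x y * b1 P Q R S x y + Q x y * b2 P Q R S x y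

def g20 (P Q R S : ℝ → ℝ → ℝ) : ℝ → ℝ → ℝ := fun x y =>
  pdy (b1 P Q R S) x y - R x y * b1 P Q R S x y + Q x y * b2 P Q R S x y

def g21 (P Q R S : ℝ → ℝ → ℝ) : ℝ → ℝ → ℝ := fun x y =>
  pdy (b2 P Q R S) x y - S x y * b1 P Q R S x y + R x y * b2 P Q R S x y

def J0 (P Q R S : ℝ → ℝ → ℝ) : ℝ → ℝ → ℝ := fun x y =>
  b2 P Q R S x y ^ 2 * g10 P Q R S x y - b1 P Q R S x y * b2 P Q R S x y * (g20 P Q R S x y + g11 P Q R S x y) + b1 P Q R S x y ^ 2 * g21 P Q R S x y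

def Gam0 (P Q R S : ℝ → ℝ → ℝ) : ℝ → ℝ → ℝ := fun x y =>
  3 * b2 P Q R S x y * g10 P Q R S x y + b1 P Q R S x y * (g20 P Q R S x y - 4 * g11 P Q R S x y)

def Gam1 (P Q R S : ℝ → ℝ → ℝ) : ℝ → ℝ → ℝ := fun x y =>
  b2 P Q R S x y * (4 * g20 P Q R S x y - g11 P Q R S x y) - 3 * b1 P Q R S x y * g21 P Q R S x y

def d10 (P Q R S : ℝ → ℝ → ℝ) : ℝ → ℝ → ℝ := fun x y =>
  pdx (g10 P Q R S) x y - 2 * Q x y * g10 P Q R S x y + P x y * (g20 P Q R S x y + g11 P Q R S x y) - 5 * al0 P Q R S x y * b1 P Q R S x y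

def d20 (P Q R S : ℝ → ℝ → ℝ) : ℝ → ℝ → ℝ := fun x y =>
  pdx (g20 P Q R S) x y - R x y * g10 P Q R S x y + P x y * g21 P Q R S x y - 4 * al1 P Q R S x y * b1 P Q R S x y - al0 P Q R S x y * b2 P Q R S x y

def d30 (P Q R S : ℝ → ℝ → ℝ) : ℝ → ℝ → ℝ := fun x y =>
  pdy (g20 P Q R S) x y - S x y * g10 P Q R S x y + Q x y * g21 P Q R S x y - 4 * al2 P Q R S x y * b1 P Q R S x y - al1 P Q R S x y * b2 P Q R S x y

def d11 (P Q R S : ℝ → ℝ → ℝ) : ℝ → ℝ → ℝ := fun x y =>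
  pdx (g11 P Q R S) x y - R x y * g10 P Q R S x y + P x y * g21 P Q R S x y - al1 P Q R S x y * b1 P Q R S x y - 4 * al0 P Q R S x y * b2 P Q R S x y

def d21 (P Q R S : ℝ → ℝ → ℝ) : ℝ → ℝ → ℝ := fun x y =>
  pdx (g21 P Q R S) x y - R x y * (g20 P Q R S x y + g11 P Q R S x y) + 2 * Q x y * g21 P Q R S x y - 5 * al1 P Q R S x y * b2 P Q R S x y

def d31 (P Q R S : ℝ → ℝ → ℝ) : ℝ → ℝ → ℝ := fun x y =>
  pdy (g21 P Q R S) x y - S x y * (g20 P Q R S x y + g11 P Q R S x y) + 2 * R x y * g21 P Q R S x y - 5 * al2 P Q R S x y * b2 P Q R S x y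

def J1 (P Q R S : ℝ → ℝ → ℝ) : ℝ → ℝ → ℝ := fun x y =>
  b2 P Q R S x y * (d20 P Q R S x y - d11 P Q R S x y) + b1 P Q R S x y * (d21 P Q R S x y - d30 P Q R S x y) + (7 / 5) * (g20 P Q R S x y - g11 P Q R S x y) ^ 2 + (3 / 5) * (g20 P Q R S x y * g11 P Q R S x y - g10 P Q R S x y * g21 P Q R S x y)

def J2 (P Q R S : ℝ → ℝ → ℝ) : ℝ → ℝ → ℝ := fun x y =>
  Gam1 P Q R S x y * (d20 P Q R S x y - d11 P Q R S x y) + Gam0 P Q R S x y * (d21 P Q R S x y - d30 P Q R S x y) + 3 * (g20 P Q R S x y - g11 P Q R S x y) * (g10 P Q R S x y * g21 P Q R S x y - g20 P Q R S x y * g11 P Q R S x y) + (4 / 3) * (g20 P Q R S x y - g11 P Q R S x y) ^ 3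

def J3 (P Q R S : ℝ → ℝ → ℝ) : ℝ → ℝ → ℝ := fun x y =>
  b2 P Q R S x y ^ 3 * d10 P Q R S x y - b1 P Q R S x y * b2 P Q R S x y ^ 2 * (2 * d20 P Q R S x y + d11 P Q R S x y) + b1 P Q R S x y ^ 2 * b2 P Q R S x y * (d30 P Q R S x y + 2 * d21 P Q R S x y) - b1 P Q R S x y ^ 3 * d31 P Q R S x y + 4 * (g20 P Q R S x y - g11 P Q R S x y) * J0 P Q R S x y

def J4 (P Q R S : ℝ → ℝ → ℝ) : ℝ → ℝ → ℝ := fun x y =>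
  -b2 P Q R S x y * (b2 P Q R S x y * Gam0 P Q R S x y + 2 * b1 P Q R S x y * Gam1 P Q R S x y) * (2 * d20 P Q R S x y + d11 P Q R S x y) + b1 P Q R S x y * (2 * b2 P Q R S x y * Gam0 P Q R S x y + b1 P Q R S x y * Gam1 P Q R S x y) * (d30 P Q R S x y + 2 * d21 P Q R S x y) + 3 * b2 P Q R S x y ^ 2 * Gam1 P Q R S x y * d10 P Q R S x y - 3 * b1 P Q R S x y ^ 2 * Gam0 P Q R S x y * d31 P Q R S x y + (66 / 5) * (g20 P Q R S x y - g11 P Q R S x y) ^ 2 * J0 P Q R S x y + (36 / 5) * (g10 P Q R S x y * g21 P Q R S x y - g20 P Q R S x y * g11 P Q R S x y) * J0 P Q R S x y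

def AA (P Q R S : ℝ → ℝ → ℝ) : ℝ → ℝ → ℝ := fun x y =>
  pdy (pdy P) x y - 2 * pdx (pdy Q) x y + pdx (pdx R) x y + 2 * P x y * pdx S x y + S x y * pdx P x y - 3 * P x y * pdy R x y - 3 * R x y * pdy P x y - 3 * Q x y * pdx R x y + 6 * Q x y * pdy Q x y

def BB (P Q R S : ℝ → ℝ → ℝ) : ℝ → ℝ → ℝ := fun x y =>
  pdx (pdx S) x y - 2 * pdx (pdy R) x y + pdy (pdy Q) x y - 2 * S x y * pdy P x y - P x y * pdy S x y + 3 * S x y * pdx Q x y + 3 * Q x y * pdx S x y + 3 * R x y * pdy Q x y - 6 * R x y * pdx R x y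

def GG (P Q R S : ℝ → ℝ → ℝ) : ℝ → ℝ → ℝ := fun x y =>
  -BB P Q R S x y * pdx (BB P Q R S) x y - 3 * AA P Q R S x y * pdy (BB P Q R S) x y + 4 * BB P Q R S x y * pdy (AA P Q R S) x y + 3 * S x y * AA P Q R S x y ^ 2 - 6 * R x y * AA P Q R S x y * BB P Q R S x y + 3 * Q x y * BB P Q R S x y ^ 2

def HH (P Q R S : ℝ → ℝ → ℝ) : ℝ → ℝ → ℝ := fun x y =>
  -AA P Q R S x y * pdy (AA P Q R S) x y - 3 * BB P Q R S x y * pdx (AA P Q R S) x y + 4 * AA P Q R S x y * pdx (BB P Q R S) x y - 3 * P x y * BB P Q R S x y ^ 2 + 6 * Q x y * AA P Q R S x y * BB P Q R S x y - 3 * R x y * AA P Q R S x y ^ 2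

def Phi (P Q R S : ℝ → ℝ → ℝ) : ℝ → ℝ → ℝ := fun x y =>
  AA P Q R S x y * BB P Q R S x y * pdy (AA P Q R S) x y + AA P Q R S x y * BB P Q R S x y * pdx (BB P Q R S) x y - AA P Q R S x y ^ 2 * pdy (BB P Q R S) x y - BB P Q R S x y ^ 2 * pdx (AA P Q R S) x y - P x y * BB P Q R S x y ^ 3 + 3 * Q x y * AA P Q R S x y * BB P Q R S x y ^ 2 - 3 * R x y * AA P Q R S x y ^ 2 * BB P Q R S x y + S x y * AA P Q R S x y ^ 3

def I3v (P Q R S F : ℝ → ℝ → ℝ) : ℝ → ℝ → ℝ := fun x y =>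
  BB P Q R S x y * (HH P Q R S x y * pdx (GG P Q R S) x y - GG P Q R S x y * pdx (HH P Q R S) x y) / (3 * F x y ^ 9) - AA P Q R S x y * (HH P Q R S x y * pdy (GG P Q R S) x y - GG P Q R S x y * pdy (HH P Q R S) x y) / (3 * F x y ^ 9) + (HH P Q R S x y * pdy F x y + GG P Q R S x y * pdx F x y) / (3 * F x y ^ 5) + BB P Q R S x y * GG P Q R S x y ^ 2 * P x y / (3 * F x y ^ 9) - (AA P Q R S x y * GG P Q R S x y ^ 2 - 2 * HH P Q R S x y * BB P Q R S x y * GG P Q R S x y) * Q x y / (3 * F x y ^ 9) + (BB P Q R S x y * HH P Q R S x y ^ 2 - 2 * HH P Q R S x y * AA P Q R S x y * GG P Q R S x y) * R x y / (3 * F x y ^ 9) - AA P Q R S x y * HH P Q R S x y ^ 2 * S x y / (3 * F x y ^ 9)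

def I6v (P Q R S F : ℝ → ℝ → ℝ) : ℝ → ℝ → ℝ := fun x y =>
  (pdy (AA P Q R S) x y - pdx (BB P Q R S) x y) / (3 * F x y ^ 2) - (AA P Q R S x y * pdy F x y - BB P Q R S x y * pdx F x y) / (3 * F x y ^ 3)

def I7v (P Q R S F : ℝ → ℝ → ℝ) : ℝ → ℝ → ℝ := fun x y =>
  (GG P Q R S x y * HH P Q R S x y * pdx (GG P Q R S) x y - GG P Q R S x y ^ 2 * pdx (HH P Q R S) x y + HH P Q R S x y ^ 2 * pdy (GG P Q R S) x y - HH P Q R S x y * GG P Q R S x y * pdy (HH P Q R S) x y) / (3 * F x y ^ 11) + (GG P Q R S x y ^ 3 * P x y + 3 * GG P Q R S x y ^ 2 * HH P Q R S x y * Q x y + 3 * GG P Q R S x y * HH P Q R S x y ^ 2 * R x y + HH P Q R S x y ^ 3 * S x y) / (3 * F x y ^ 11)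

def I8v (P Q R S F : ℝ → ℝ → ℝ) : ℝ → ℝ → ℝ := fun x y =>
  GG P Q R S x y * (AA P Q R S x y * pdx (GG P Q R S) x y + BB P Q R S x y * pdx (HH P Q R S) x y) / (3 * F x y ^ 9) + HH P Q R S x y * (AA P Q R S x y * pdy (GG P Q R S) x y + BB P Q R S x y * pdy (HH P Q R S) x y) / (3 * F x y ^ 9) - 10 * (HH P Q R S x y * pdy F x y + GG P Q R S x y * pdx F x y) / (3 * F x y ^ 5) - BB P Q R S x y * GG P Q R S x y ^ 2 * P x y / (3 * F x y ^ 9) + (AA P Q R S x y * GG P Q R S x y ^ 2 - 2 * HH P Q R S x y * BB P Q R S x y * GG P Q R S x y) * Q x y / (3 * F x y ^ 9) - (BB P Q R S x y * HH P Q R S x y ^ 2 - 2 * HH P Q R S x y * AA P Q R S x y * GG P Q R S x y) * R x y / (3 * F x y ^ 9) + AA P Q R S x y * HH P Q R S x y ^ 2 * S x y / (3 * F x y ^ 9)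

def XX (P Q R S F f : ℝ → ℝ → ℝ) : ℝ → ℝ → ℝ := fun x y =>
  (BB P Q R S x y * pdx f x y - AA P Q R S x y * pdy f x y) / F x y ^ 2

def YY (P Q R S F f : ℝ → ℝ → ℝ) : ℝ → ℝ → ℝ := fun x y =>
  (GG P Q R S x y * pdx f x y + HH P Q R S x y * pdy f x y) / F x y ^ 4

def IBgd1 (P Q R S F : ℝ → ℝ → ℝ) : ℝ → ℝ → ℝ := fun x y =>
  J1 P Q R S x y / F x y ^ 4

def IBgd2 (P Q R S F : ℝ → ℝ → ℝ) : ℝ → ℝ → ℝ := fun x y =>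
  J2 P Q R S x y / F x y ^ 6

def IBgd3 (P Q R S F : ℝ → ℝ → ℝ) : ℝ → ℝ → ℝ := fun x y =>
  -(J3 P Q R S x y / F x y ^ 7)

def IBgd4 (P Q R S F : ℝ → ℝ → ℝ) : ℝ → ℝ → ℝ := fun x y =>
  -(J4 P Q R S x y / F x y ^ 9)


section PartialDerivatives

variable {f : ℝ → ℝ → ℝ}

lemma hasDerivAt_fst_section (hf : Differentiable ℝ (uncurry f)) (x y : ℝ) :
    HasDerivAt (fun t => f t y) (fderiv ℝ (uncurry f) (x, y) (1, 0)) x :=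
  (hf (x, y)).hasFDerivAt.comp_hasDerivAt (f := fun t => (t, y)) x
    ((hasDerivAt_id x).prodMk (hasDerivAt_const x y))

lemma hasDerivAt_snd_section (hf : Differentiable ℝ (uncurry f)) (x y : ℝ) :
    HasDerivAt (fun t => f x t) (fderiv ℝ (uncurry f) (x, y) (0, 1)) y :=
  (hf (x, y)).hasFDerivAt.comp_hasDerivAt (f := fun t => (x, t)) y
    ((hasDerivAt_const y x).prodMk (hasDerivAt_id y))

lemma uncurry_pdx (hf : Differentiable ℝ (uncurry f)) :
    uncurry (pdx f) = fun p => fderiv ℝ (uncurry f) p (1, 0) :=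
  funext fun p => (hasDerivAt_fst_section hf p.1 p.2).deriv

lemma uncurry_pdy (hf : Differentiable ℝ (uncurry f)) :
    uncurry (pdy f) = fun p => fderiv ℝ (uncurry f) p (0, 1) :=
  funext fun p => (hasDerivAt_snd_section hf p.1 p.2).deriv

lemma hasDerivAt_pdx (hf : Differentiable ℝ (uncurry f)) (x y : ℝ) :
    HasDerivAt (fun t => f t y) (pdx f x y) x :=
  (hasDerivAt_fst_section hf x y).differentiableAt.hasDerivAt

lemma hasDerivAt_pdy (hf : Differentiable ℝ (uncurry f)) (x y : ℝ) :
    HasDerivAt (fun t => f x t) (pdy f x y) y :=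
  (hasDerivAt_snd_section hf x y).differentiableAt.hasDerivAt

lemma differentiable_pdx (hf : ContDiff ℝ 2 (uncurry f)) : Differentiable ℝ (uncurry (pdx f)) := by
  rw [uncurry_pdx (hf.differentiable (by norm_num))]
  exact ((hf.fderiv_right (m := 1) (by norm_num)).differentiable (by norm_num)).clm_apply
    (differentiable_const _)

lemma differentiable_pdy (hf : ContDiff ℝ 2 (uncurry f)) : Differentiable ℝ (uncurry (pdy f)) := by
  rw [uncurry_pdy (hf.differentiable (by norm_num))]
  exact ((hf.fderiv_right (m := 1) (by norm_num)).differentiable (by norm_num)).clm_apply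
    (differentiable_const _)

lemma pdy_pdx_comm (hf : ContDiff ℝ 2 (uncurry f)) (x y : ℝ) :
    pdy (pdx f) x y = pdx (pdy f) x y := by
  have hd : Differentiable ℝ (uncurry f) := hf.differentiable (by norm_num)
  have hd' : DifferentiableAt ℝ (fderiv ℝ (uncurry f)) (x, y) :=
    (hf.fderiv_right (m := 1) (by norm_num)).differentiable (by norm_num) _
  have hyx : pdy (pdx f) x y = fderiv ℝ (fderiv ℝ (uncurry f)) (x, y) (0, 1) (1, 0) := by
    refine (hasDerivAt_snd_section (differentiable_pdx hf) x y).deriv.trans ?_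
    rw [uncurry_pdx hd, fderiv_clm_apply hd' (differentiableAt_const _)]
    simp
  have hxy : pdx (pdy f) x y = fderiv ℝ (fderiv ℝ (uncurry f)) (x, y) (1, 0) (0, 1) := by
    refine (hasDerivAt_fst_section (differentiable_pdy hf) x y).deriv.trans ?_
    rw [uncurry_pdy hd, fderiv_clm_apply hd' (differentiableAt_const _)]
    simp
  rw [hyx, hxy]
  exact (hf.contDiffAt.isSymmSndFDerivAt (by simp)).eq _ _

end PartialDerivatives

section RelativeInvariants

variable {P Q R S : ℝ → ℝ → ℝ}

lemma b1_eq_AA (hP : ContDiff ℝ 2 (uncurry P)) (hQ : ContDiff ℝ 2 (uncurry Q))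
    (hR : ContDiff ℝ 2 (uncurry R)) (hS : ContDiff ℝ 2 (uncurry S)) :
    b1 P Q R S = AA P Q R S := by
  funext x y
  have hP' := hP.differentiable (by norm_num)
  have hQ' := hQ.differentiable (by norm_num)
  have hR' := hR.differentiable (by norm_num)
  have hS' := hS.differentiable (by norm_num)
  have h₁ : pdx (al1 P Q R S) x y = _ :=
    ((((hasDerivAt_pdx (differentiable_pdx hR) x y).sub
      (hasDerivAt_pdx (differentiable_pdy hQ) x y)).add
      ((hasDerivAt_pdx hP' x y).mul (hasDerivAt_pdx hS' x y))).sub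
      ((hasDerivAt_pdx hQ' x y).mul (hasDerivAt_pdx hR' x y))).deriv
  have h₀ : pdy (al0 P Q R S) x y = _ :=
    ((((hasDerivAt_pdy (differentiable_pdx hQ) x y).sub
      (hasDerivAt_pdy (differentiable_pdy hP) x y)).add
      (((hasDerivAt_pdy hP' x y).const_mul 2).mul (hasDerivAt_pdy hR' x y))).sub
      (((hasDerivAt_pdy hQ' x y).pow 2).const_mul 2)).deriv
  rw [b1, h₁, h₀, pdy_pdx_comm hQ]
  simp only [al0, al1, al2, AA]
  ring

lemma b2_eq_BB (hP : ContDiff ℝ 2 (uncurry P)) (hQ : ContDiff ℝ 2 (uncurry Q))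
    (hR : ContDiff ℝ 2 (uncurry R)) (hS : ContDiff ℝ 2 (uncurry S)) :
    b2 P Q R S = BB P Q R S := by
  funext x y
  have hP' := hP.differentiable (by norm_num)
  have hQ' := hQ.differentiable (by norm_num)
  have hR' := hR.differentiable (by norm_num)
  have hS' := hS.differentiable (by norm_num)
  have h₂ : pdx (al2 P Q R S) x y = _ :=
    ((((hasDerivAt_pdx (differentiable_pdx hS) x y).sub
      (hasDerivAt_pdx (differentiable_pdy hR) x y)).add
      (((hasDerivAt_pdx hQ' x y).const_mul 2).mul (hasDerivAt_pdx hS' x y))).sub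
      (((hasDerivAt_pdx hR' x y).pow 2).const_mul 2)).deriv
  have h₁ : pdy (al1 P Q R S) x y = _ :=
    ((((hasDerivAt_pdy (differentiable_pdx hR) x y).sub
      (hasDerivAt_pdy (differentiable_pdy hQ) x y)).add
      ((hasDerivAt_pdy hP' x y).mul (hasDerivAt_pdy hS' x y))).sub
      ((hasDerivAt_pdy hQ' x y).mul (hasDerivAt_pdy hR' x y))).deriv
  rw [b2, h₂, h₁, pdy_pdx_comm hR]
  simp only [al0, al1, al2, BB]
  ring

lemma J0_eq_neg_Phi (hP : ContDiff ℝ 2 (uncurry P)) (hQ : ContDiff ℝ 2 (uncurry Q))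
    (hR : ContDiff ℝ 2 (uncurry R)) (hS : ContDiff ℝ 2 (uncurry S)) (x y : ℝ) :
    J0 P Q R S x y = -Phi P Q R S x y := by
  simp only [J0, g10, g11, g20, g21, Phi, b1_eq_AA hP hQ hR hS, b2_eq_BB hP hQ hR hS]
  ring

end RelativeInvariants

theorem stmt3 (P Q R S : ℝ → ℝ → ℝ)
    (hP : ContDiff ℝ (⊤ : ℕ∞) (uncurry P)) (hQ : ContDiff ℝ (⊤ : ℕ∞) (uncurry Q))
    (hR : ContDiff ℝ (⊤ : ℕ∞) (uncurry R)) (hS : ContDiff ℝ (⊤ : ℕ∞) (uncurry S)) :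
    ∀ x y : ℝ, J0 P Q R S x y ≠ 0 ↔ Phi P Q R S x y ≠ 0 := by
  have h2 : (2 : WithTop ℕ∞) ≤ (⊤ : ℕ∞) := WithTop.coe_le_coe.2 (le_top : (2 : ℕ∞) ≤ ⊤)
  intro x y
  rw [J0_eq_neg_Phi (hP.of_le h2) (hQ.of_le h2) (hR.of_le h2) (hS.of_le h2), neg_ne_zero]
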